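/- arXiv:2206.12691 — 3 statements merged into one kernel-verified Lean document; each statement's English description precedes it below -/
import Mathlib

section
/- Let α₁, α₂, α₃, α₄ ∈ (0, π) be the sector angles of a developable degree-4 rigid origami vertex, i.e. α₁+α₂+α₃+α₄ = 2π, and let (ρ₁, ρ₂, ρ₃, ρ₄) satisfy the rotation-matrix closure condition. Then for each i ∈ {1,2,3,4} (indices modulo 4) with ρ_{i−1}, ρ_i, ρ_{i+1} ∈ (−π, π) all nonzero, the folding angles satisfy sin(α_{i+1}+α_{i+2}) / tan(ρ_i/2) = sin α_i / tan(ρ_{i−1}/2) + sin α_{i−1} / tan(ρ_{i+1}/2). (Theorem 3, Eq. (10).) -/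
open Real Matrix

/-- Rotation of ℝ³ by angle `β` about the x-axis. -/
noncomputable def Rx (β : ℝ) : Matrix (Fin 3) (Fin 3) ℝ :=
  !![1, 0, 0;
     0, Real.cos β, -Real.sin β;
     0, Real.sin β, Real.cos β]

/-- Rotation of ℝ³ by angle `β` about the z-axis. -/
noncomputable def Rz (β : ℝ) : Matrix (Fin 3) (Fin 3) ℝ :=
  !![Real.cos β, -Real.sin β, 0;
     Real.sin β, Real.cos β, 0;
     0, 0, 1]

/-- The spherical-linkage loop (closure) condition for a degree-4 origami vertex with
sector angles `α₁, α₂, α₃, α₄` and folding angles `ρ₁, ρ₂, ρ₃, ρ₄`. -/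
def ClosureCond (α₁ α₂ α₃ α₄ ρ₁ ρ₂ ρ₃ ρ₄ : ℝ) : Prop :=
  Rx ρ₁ * Rz α₁ * Rx ρ₂ * Rz α₂ * Rx ρ₃ * Rz α₃ * Rx ρ₄ * Rz α₄ = 1

/-- Closure condition, `Fin 4`-indexed version (index `j` ↔ paper index `j+1`). -/
def ClosureCondF (α ρ : Fin 4 → ℝ) : Prop :=
  ClosureCond (α 0) (α 1) (α 2) (α 3) (ρ 0) (ρ 1) (ρ 2) (ρ 3)

theorem Rx_orth (b : ℝ) : Rx b * (Rx b)ᵀ = 1 := by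
  have h := Real.sin_sq_add_cos_sq b
  ext i j
  fin_cases i <;> fin_cases j <;> simp [Rx, Matrix.mul_apply, Fin.sum_univ_three] <;> linarith

theorem Rz_orth (b : ℝ) : Rz b * (Rz b)ᵀ = 1 := by
  have h := Real.sin_sq_add_cos_sq b
  ext i j
  fin_cases i <;> fin_cases j <;> simp [Rz, Matrix.mul_apply, Fin.sum_univ_three] <;> linarith

theorem orth_mul {A B : Matrix (Fin 3) (Fin 3) ℝ} (hA : A * Aᵀ = 1) (hB : B * Bᵀ = 1) :
    (A * B) * (A * B)ᵀ = 1 := by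
  rw [Matrix.transpose_mul, Matrix.mul_assoc, ← Matrix.mul_assoc B, hB, Matrix.one_mul, hA]

theorem closure_rot {a b c d p q r s : ℝ} (h : ClosureCond a b c d p q r s) :
    ClosureCond b c d a q r s p := by
  unfold ClosureCond at *
  have h' : (Rx p * Rz a) * (Rx q * Rz b * Rx r * Rz c * Rx s * Rz d) = 1 := by
    rw [← h]; simp only [Matrix.mul_assoc]
  have h2 := mul_eq_one_comm.mp h'
  rw [← h2]; simp only [Matrix.mul_assoc]

theorem half_ne {r : ℝ} (h : r ∈ Set.Ioo (-π) π) (h0 : r ≠ 0) : Real.sin (r / 2) ≠ 0 := by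
  intro hs
  have := (Real.sin_eq_zero_iff_of_lt_of_lt (by linarith [h.1, Real.pi_pos])
    (by linarith [h.2, Real.pi_pos])).mp hs
  exact h0 (by linarith)

theorem key {a b c d p q r s : ℝ} (ha : a ∈ Set.Ioo 0 π) (hb : b ∈ Set.Ioo 0 π)
    (hd : d ∈ Set.Ioo 0 π) (hdev : a + b + c + d = 2 * π)
    (h : ClosureCond a b c d p q r s)
    (hs : s ∈ Set.Ioo (-π) π) (hp : p ∈ Set.Ioo (-π) π) (hq : q ∈ Set.Ioo (-π) π)
    (hs0 : s ≠ 0) (hp0 : p ≠ 0) (hq0 : q ≠ 0) :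
    Real.sin (b + c) / Real.tan (p / 2)
      = Real.sin a / Real.tan (s / 2) + Real.sin d / Real.tan (q / 2) := by
  have hE : Rx p * (Rz a * Rx q * Rz b) = (Rx r * (Rz c * Rx s * Rz d))ᵀ := by
    have hQ : (Rx r * (Rz c * Rx s * Rz d)) * (Rx r * (Rz c * Rx s * Rz d))ᵀ = 1 :=
      orth_mul (Rx_orth _) (orth_mul (orth_mul (Rz_orth _) (Rx_orth _)) (Rz_orth _))
    have hPQ : Rx p * (Rz a * Rx q * Rz b) * (Rx r * (Rz c * Rx s * Rz d)) = 1 := by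
      rw [← h]; simp only [Matrix.mul_assoc]
    calc _ = Rx p * (Rz a * Rx q * Rz b) *
          ((Rx r * (Rz c * Rx s * Rz d)) * (Rx r * (Rz c * Rx s * Rz d))ᵀ) := by
          rw [hQ, Matrix.mul_one]
      _ = _ := by rw [← Matrix.mul_assoc, hPQ, Matrix.one_mul]
  have e0 := congrFun (congrFun hE 0) 0
  have e1 := congrFun (congrFun hE 1) 0
  have e2 := congrFun (congrFun hE 2) 0
  simp [Rx, Rz, Matrix.mul_apply, Fin.sum_univ_three] at e0 e1 e2
  have hS : ∀ x : ℝ, Real.sin x = 2 * Real.sin (x / 2) * Real.cos (x / 2) := fun x => by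
    rw [← Real.sin_two_mul]; congr 1; ring
  have hC : ∀ x : ℝ, Real.cos x = 1 - 2 * Real.sin (x / 2) ^ 2 := fun x => by
    have h1 := Real.cos_two_mul (x / 2)
    have h2 := Real.sin_sq_add_cos_sq (x / 2)
    rw [show 2 * (x / 2) = x by ring] at h1
    linarith
  have np := half_ne hp hp0
  have nq := half_ne hq hq0
  have ns := half_ne hs hs0
  have hab : a + b = 2 * π - (c + d) := by linarith
  have hc1 : Real.cos (a + b) = Real.cos (c + d) := by rw [hab, Real.cos_two_pi_sub]
  have hs1 : Real.sin (a + b) = - Real.sin (c + d) := by rw [hab, Real.sin_two_pi_sub]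
  have hbc : Real.sin (b + c) = - Real.sin (a + d) := by
    rw [show b + c = 2 * π - (a + d) by linarith, Real.sin_two_pi_sub]
  rw [Real.cos_add, Real.cos_add] at hc1
  rw [Real.sin_add, Real.sin_add] at hs1
  rw [hbc, Real.sin_add]
  have pa := Real.sin_pos_of_pos_of_lt_pi ha.1 ha.2
  have pb := Real.sin_pos_of_pos_of_lt_pi hb.1 hb.2
  have pd := Real.sin_pos_of_pos_of_lt_pi hd.1 hd.2
  rw [hS p, hS q, hC p, hC q, hC s] at e1
  rw [hS p, hS q, hC p, hC q, hS s] at e2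
  rw [hC q, hC s] at e0
  have tp := Real.sin_sq_add_cos_sq (p / 2)
  simp only [Real.tan_eq_sin_div_cos]
  generalize Real.sin (p / 2) = P at *
  generalize Real.cos (p / 2) = P' at *
  generalize Real.sin (q / 2) = Q at *
  generalize Real.cos (q / 2) = Q' at *
  generalize Real.sin (s / 2) = S at *
  generalize Real.cos (s / 2) = S' at *
  generalize Real.sin a = sa at *
  generalize Real.cos a = ca at *
  generalize Real.sin b = sb at *
  generalize Real.cos b = cb at *
  generalize Real.sin c = sc at *
  generalize Real.cos c = cc at *
  generalize Real.sin d = sd at *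
  generalize Real.cos d = cd at *
  have f0 : sa * sb * Q ^ 2 = sc * sd * S ^ 2 := by linear_combination (e0 - hc1) / 2
  set vy := sa * cb + ca * sb * (1 - 2 * Q ^ 2) with hvy
  set vz := 2 * sb * Q * Q' with hvz
  set wy := -(cc * sd) - sc * (1 - 2 * S ^ 2) * cd with hwy
  set wz := 2 * sc * S * S' with hwz
  have g1 : (1 - 2 * P ^ 2) * vy - 2 * P * P' * vz = wy := by
    rw [hvy, hvz, hwy]; linear_combination e1
  have g2 : 2 * P * P' * vy + (1 - 2 * P ^ 2) * vz = wz := by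
    rw [hvz, hwz, hvy]; linear_combination e2
  have g3 : P' * (wy - vy) + P * (vz + wz) = 0 := by
    rw [← g1, ← g2]; linear_combination (-2 * P * vz) * tp
  have g4 : P' * (cd * sc * S ^ 2 + ca * sb * Q ^ 2) + P * (sb * Q * Q' + sc * S * S') = 0 := by
    rw [hvy, hvz, hwy, hwz] at g3; linear_combination g3 / 2 + P' / 2 * hs1
  have g5 : sa * sb * Q ^ 2 * (P' * Q * S * (sa * cd + ca * sd)
      + P * (sd * Q' * S + sa * S' * Q)) = 0 := by
    linear_combination sa * sd * Q * S * g4 + (P' * sa * cd * Q * S + P * sa * S' * Q) * f0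
  have g6 := (mul_eq_zero.mp g5).resolve_left (by positivity)
  field_simp
  linear_combination -g6

/-- Theorem 3, Eq. (10): the three-crease folding-angle relation for a general
developable degree-4 rigid origami vertex. -/
theorem developable_adjacent_relation (α ρ : Fin 4 → ℝ)
    (hα : ∀ j, α j ∈ Set.Ioo 0 π)
    (hdev : α 0 + α 1 + α 2 + α 3 = 2 * π)
    (hclose : ClosureCondF α ρ) :
    ∀ i : Fin 4,
      ρ (i + 3) ∈ Set.Ioo (-π) π → ρ i ∈ Set.Ioo (-π) π → ρ (i + 1) ∈ Set.Ioo (-π) π →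
      ρ (i + 3) ≠ 0 → ρ i ≠ 0 → ρ (i + 1) ≠ 0 →
      Real.sin (α (i + 1) + α (i + 2)) / Real.tan (ρ i / 2)
        = Real.sin (α i) / Real.tan (ρ (i + 3) / 2)
          + Real.sin (α (i + 3)) / Real.tan (ρ (i + 1) / 2) := by
  unfold ClosureCondF at hclose
  have h1 := closure_rot hclose
  have h2 := closure_rot h1
  have h3 := closure_rot h2
  have d1 : α 1 + α 2 + α 3 + α 0 = 2 * π := by linarith
  have d2 : α 2 + α 3 + α 0 + α 1 = 2 * π := by linarith
  have d3 : α 3 + α 0 + α 1 + α 2 = 2 * π := by linarith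
  intro i
  fin_cases i
  · exact key (hα 0) (hα 1) (hα 3) hdev hclose
  · exact key (hα 1) (hα 2) (hα 0) d1 h1
  · exact key (hα 2) (hα 3) (hα 1) d2 h2
  · exact key (hα 3) (hα 0) (hα 2) d3 h3
end

section
/- Let α₁, α₂, α₃, α₄ ∈ (0, π) be the sector angles of a developable degree-4 rigid origami vertex, i.e. α₁+α₂+α₃+α₄ = 2π, and let (ρ₁, ρ₂, ρ₃, ρ₄) ∈ ℝ⁴ satisfy the rotation-matrix closure condition. Then for each i ∈ {1,2,3,4} (indices modulo 4) the opposite folding angles satisfy Huffman's relation sin α_{i−1} · sin α_i · sin²(ρ_i/2) = sin α_{i+1} · sin α_{i+2} · sin²(ρ_{i+2}/2). -/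
open Real Matrix

lemma Rx_inv (b : ℝ) : Rx b * Rx (-b) = 1 := by
  have h := Real.sin_sq_add_cos_sq b
  ext i j
  fin_cases i <;> fin_cases j <;> simp [Rx, Matrix.mul_apply, Fin.sum_univ_three] <;> linarith

lemma Rz_inv (b : ℝ) : Rz b * Rz (-b) = 1 := by
  have h := Real.sin_sq_add_cos_sq b
  ext i j
  fin_cases i <;> fin_cases j <;> simp [Rz, Matrix.mul_apply, Fin.sum_univ_three] <;> linarith

lemma Rx_inv' (b : ℝ) : Rx (-b) * Rx b = 1 := by
  simpa using Rx_inv (-b)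

lemma closure_shift {a b c d p q r s : ℝ} (h : ClosureCond a b c d p q r s) :
    ClosureCond d a b c s p q r := by
  unfold ClosureCond at *
  have h2 : (Rx p * Rz a * Rx q * Rz b * Rx r * Rz c) * (Rx s * Rz d) = 1 := by
    rw [← h]; simp only [Matrix.mul_assoc]
  rw [← _root_.mul_eq_one_comm.mp h2]; simp only [Matrix.mul_assoc]

lemma closure_key {a b c d p q r s : ℝ} (h : ClosureCond a b c d p q r s)
    (hs : a + b + c + d = 2 * π) :
    sin a * sin b * sin (q / 2) ^ 2 = sin c * sin d * sin (s / 2) ^ 2 := by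
  unfold ClosureCond at h
  have e : Rz a * Rx q * Rz b = Rx (-p) * (Rz (-d) * Rx (-s) * Rz (-c)) * Rx (-r) := by
    have h1 : (Rx p * (Rz a * Rx q * Rz b) * Rx r) * (Rz c * Rx s * Rz d) = 1 := by
      rw [← h]; simp only [Matrix.mul_assoc]
    have h2 : (Rz c * Rx s * Rz d) * (Rz (-d) * Rx (-s) * Rz (-c)) = 1 := by
      calc _ = Rz c * (Rx s * (Rz d * Rz (-d)) * Rx (-s)) * Rz (-c) := by
            simp only [Matrix.mul_assoc]
        _ = 1 := by rw [Rz_inv, Matrix.mul_one, Rx_inv, Matrix.mul_one, Rz_inv]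
    have h3 : Rz (-d) * Rx (-s) * Rz (-c) = Rx p * (Rz a * Rx q * Rz b) * Rx r :=
      (left_inv_eq_right_inv h1 h2).symm
    rw [h3]
    calc _ = (Rx (-p) * Rx p) * (Rz a * Rx q * Rz b) * (Rx r * Rx (-r)) := by
          rw [Rx_inv', Rx_inv, Matrix.one_mul, Matrix.mul_one]
      _ = _ := by simp only [Matrix.mul_assoc]
  have e0 := congrFun (congrFun e 0) 0
  simp [Rx, Rz, Matrix.mul_apply, Fin.sum_univ_three] at e0
  have hc : cos (a + b) = cos (c + d) := by
    rw [show a + b = 2 * π - (c + d) by linarith, Real.cos_two_pi_sub]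
  rw [Real.cos_add, Real.cos_add] at hc
  rw [Real.sin_sq_eq_half_sub, Real.sin_sq_eq_half_sub,
    show 2 * (q / 2) = q by ring, show 2 * (s / 2) = s by ring]
  linarith

/-- Huffman's relation (Eq. (3)) between opposite folding angles of a developable
degree-4 rigid origami vertex. -/
theorem huffman_opposite_relation (α ρ : Fin 4 → ℝ)
    (hα : ∀ j, α j ∈ Set.Ioo 0 π)
    (hdev : α 0 + α 1 + α 2 + α 3 = 2 * π)
    (hclose : ClosureCondF α ρ) :
    ∀ i : Fin 4,
      Real.sin (α (i + 3)) * Real.sin (α i) * Real.sin (ρ i / 2) ^ 2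
        = Real.sin (α (i + 1)) * Real.sin (α (i + 2)) * Real.sin (ρ (i + 2) / 2) ^ 2 := by
  have k1 := closure_key hclose hdev
  have k0 := closure_key (closure_shift hclose) (by linarith)
  intro i
  fin_cases i
  · exact k0
  · exact k1
  · have : sin (α 1) * sin (α 2) * sin (ρ 2 / 2) ^ 2
        = sin (α 3) * sin (α 0) * sin (ρ 0 / 2) ^ 2 := k0.symm
    exact this
  · have : sin (α 2) * sin (α 3) * sin (ρ 3 / 2) ^ 2
        = sin (α 0) * sin (α 1) * sin (ρ 1 / 2) ^ 2 := k1.symm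
    exact this
end

section
/- Consider a (possibly non-developable) bird's-foot degree-4 rigid origami vertex: sector angles with α₁ = α₂ ∈ (0, π) and α₃ = α₄ ∈ (0, π). If (ρ₁, ρ₂, ρ₃, ρ₄) satisfies the rotation-matrix closure condition with ρ₁, ρ₄ ∈ (−π, π) and ρ₁ ≠ 0, then tan(ρ₄/2) = (sin α₃ · cot α₁ + cos α₃ · cos ρ₁) / sin ρ₁. -/
open Real Matrix

lemma Rx_mul_neg (β : ℝ) : Rx β * Rx (-β) = 1 := by
  have h := Real.sin_sq_add_cos_sq β
  ext i j
  fin_cases i <;> fin_cases j <;> simp [Rx, Matrix.mul_apply, Fin.sum_univ_three] <;> linarith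

lemma Rz_mul_neg (β : ℝ) : Rz β * Rz (-β) = 1 := by
  have h := Real.sin_sq_add_cos_sq β
  ext i j
  fin_cases i <;> fin_cases j <;> simp [Rz, Matrix.mul_apply, Fin.sum_univ_three] <;> linarith

/-- Eq. (10) of Example 2: `ρ₄` as a function of `ρ₁` for a (possibly non-developable)
bird's-foot degree-4 vertex. -/
theorem birds_foot_rho4 (α₁ α₂ α₃ α₄ ρ₁ ρ₂ ρ₃ ρ₄ : ℝ)
    (hα₁ : α₁ ∈ Set.Ioo 0 π) (hα₃ : α₃ ∈ Set.Ioo 0 π)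
    (h12 : α₁ = α₂) (h34 : α₃ = α₄)
    (hρ₁ : ρ₁ ∈ Set.Ioo (-π) π) (hρ₄ : ρ₄ ∈ Set.Ioo (-π) π) (hρ₁0 : ρ₁ ≠ 0)
    (hclose : ClosureCond α₁ α₂ α₃ α₄ ρ₁ ρ₂ ρ₃ ρ₄) :
    Real.tan (ρ₄ / 2)
      = (Real.sin α₃ * Real.cot α₁ + Real.cos α₃ * Real.cos ρ₁) / Real.sin ρ₁ := by
  subst h12 h34
  have hA : 0 < Real.sin α₁ := Real.sin_pos_of_mem_Ioo hα₁
  have hB : 0 < Real.sin α₃ := Real.sin_pos_of_mem_Ioo hα₃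
  have hS : Real.sin ρ₁ ≠ 0 := by
    intro h
    exact hρ₁0 ((Real.sin_eq_zero_iff_of_lt_of_lt hρ₁.1 hρ₁.2).1 h)
  have hC : 0 < Real.cos (ρ₄ / 2) := by
    apply Real.cos_pos_of_mem_Ioo
    constructor <;> linarith [hρ₄.1, hρ₄.2]
  have h1 : (Rx ρ₁ * Rz α₁ * (Rx ρ₂ * Rz α₁ * Rx ρ₃)) * (Rz α₃ * Rx ρ₄ * Rz α₃) = 1 := by
    rw [← hclose]; simp only [Matrix.mul_assoc]
  have h2 := mul_eq_one_comm.1 h1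
  have hQ : (Rx ρ₂ * Rz α₁ * Rx ρ₃) * (Rx (-ρ₃) * Rz (-α₁) * Rx (-ρ₂)) = 1 := by
    calc _ = Rx ρ₂ * (Rz α₁ * (Rx ρ₃ * Rx (-ρ₃)) * Rz (-α₁)) * Rx (-ρ₂) := by
          simp only [Matrix.mul_assoc]
      _ = 1 := by rw [Rx_mul_neg, Matrix.mul_one, Rz_mul_neg, Matrix.mul_one, Rx_mul_neg]
  have h3 : Rz α₃ * Rx ρ₄ * Rz α₃ * Rx ρ₁ * Rz α₁ = Rx (-ρ₃) * Rz (-α₁) * Rx (-ρ₂) := by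
    calc _ = Rz α₃ * Rx ρ₄ * Rz α₃ * Rx ρ₁ * Rz α₁ *
          ((Rx ρ₂ * Rz α₁ * Rx ρ₃) * (Rx (-ρ₃) * Rz (-α₁) * Rx (-ρ₂))) := by
          rw [hQ, Matrix.mul_one]
      _ = ((Rz α₃ * Rx ρ₄ * Rz α₃) * (Rx ρ₁ * Rz α₁ * (Rx ρ₂ * Rz α₁ * Rx ρ₃))) *
          (Rx (-ρ₃) * Rz (-α₁) * Rx (-ρ₂)) := by simp only [Matrix.mul_assoc]
      _ = _ := by rw [h2, Matrix.one_mul]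
  have h4 := congrFun (congrFun h3 0) 0
  simp [Rx, Rz, Matrix.mul_apply, Fin.sum_univ_three] at h4
  have hc4 : Real.cos ρ₄ = 2 * Real.cos (ρ₄ / 2) ^ 2 - 1 := by
    rw [← Real.cos_two_mul]; congr 1; ring
  have hs4 : Real.sin ρ₄ = 2 * Real.sin (ρ₄ / 2) * Real.cos (ρ₄ / 2) := by
    rw [← Real.sin_two_mul]; congr 1; ring
  rw [hc4, hs4] at h4
  have hb := Real.sin_sq_add_cos_sq α₃
  rw [Real.tan_eq_sin_div_cos, Real.cot_eq_cos_div_sin]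
  have key : 2 * Real.sin α₃ * Real.cos (ρ₄ / 2) *
      (Real.sin (ρ₄ / 2) * Real.sin α₁ * Real.sin ρ₁ - Real.cos (ρ₄ / 2) *
      (Real.sin α₃ * Real.cos α₁ + Real.cos α₃ * Real.cos ρ₁ * Real.sin α₁)) = 0 := by
    linear_combination h4 - Real.cos α₁ * hb
  have key2 := (mul_eq_zero.1 key).resolve_left (by positivity)
  field_simp
  linear_combination key2
end
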